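/- arXiv:2407.21306 — 7 statements merged into one kernel-verified Lean document; each statement's English description precedes it below -/
import Mathlib

section
/- There exists a constant C > 0 such that for every integer d ≥ 1 and every α ∈ (0,2), one has A(d,α)·ω_{d-1} / (d(2-α)) ≤ C. -/
open Real

/-- `A(d,α) = α Γ((d+α)/2) / (2^{2-α} π^{d/2} Γ(1-α/2))`. -/
noncomputable def stableA (d : ℕ) (α : ℝ) : ℝ :=
  α * Real.Gamma ((d + α) / 2) /
    ((2 : ℝ) ^ ((2 : ℝ) - α) * Real.pi ^ ((d : ℝ) / 2) * Real.Gamma (1 - α / 2))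

/-- `ω_{d-1} = 2 π^{d/2} / Γ(d/2)`. -/
noncomputable def omegaSphere (d : ℕ) : ℝ :=
  2 * Real.pi ^ ((d : ℝ) / 2) / Real.Gamma ((d : ℝ) / 2)

theorem Gamma_add_le_mul {x s m : ℝ} (hx : 0 < x) (hs₀ : 0 ≤ s) (hs₁ : s ≤ 1)
    (hm₁ : 1 ≤ m) (hxm : x ≤ m) : Real.Gamma (x + s) ≤ m * Real.Gamma x := by
  have h := Real.convexOn_Gamma.2 (Set.mem_Ioi.2 hx)
    (Set.mem_Ioi.2 (by linarith : (0 : ℝ) < x + 1))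
    (sub_nonneg.2 hs₁) hs₀ (by ring)
  simp only [smul_eq_mul] at h
  rw [Real.Gamma_add_one hx.ne', show (1 - s) * x + s * (x + 1) = x + s by ring] at h
  have hc : 1 - s + s * x ≤ m := by nlinarith
  nlinarith [mul_le_mul_of_nonneg_right hc (Real.Gamma_pos_of_pos hx).le]

theorem one_half_le_Gamma {t : ℝ} (h₁ : 1 ≤ t) (h₂ : t ≤ 2) : 1 / 2 ≤ Real.Gamma t := by
  have h := Real.Gamma_strictMonoOn_Ici.monotoneOn (Set.mem_Ici.2 le_rfl)
    (Set.mem_Ici.2 (by linarith : (2 : ℝ) ≤ t + 1)) (by linarith)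
  rw [Real.Gamma_two, Real.Gamma_add_one (by linarith)] at h
  nlinarith [Real.Gamma_pos_of_pos (by linarith : 0 < t)]

theorem stmt0 :
    ∃ C : ℝ, 0 < C ∧ ∀ (d : ℕ), 1 ≤ d → ∀ α : ℝ, 0 < α → α < 2 →
      stableA d α * omegaSphere d / (d * (2 - α)) ≤ C := by
  refine ⟨4, by norm_num, fun d hd α hα₀ hα₂ => ?_⟩
  have hd' : (1 : ℝ) ≤ d := by exact_mod_cast hd
  have hx : (0 : ℝ) < (d : ℝ) / 2 := by linarith
  have hG := Real.Gamma_pos_of_pos hx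
  have hH := Real.Gamma_pos_of_pos (by linarith : 0 < 1 - α / 2)
  have hnum : Real.Gamma ((d + α) / 2) ≤ d * Real.Gamma ((d : ℝ) / 2) := by
    rw [add_div]
    exact Gamma_add_le_mul hx (by linarith) (by linarith) hd' (by linarith)
  have hden : 1 ≤ (2 - α) * Real.Gamma (1 - α / 2) := by
    have h := one_half_le_Gamma (t := 1 - α / 2 + 1) (by linarith) (by linarith)
    rw [Real.Gamma_add_one (by linarith)] at h
    linarith
  have hpow : 1 ≤ (2 : ℝ) ^ (2 - α) := Real.one_le_rpow (by norm_num) (by linarith)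
  have hpi : 0 < Real.pi ^ ((d : ℝ) / 2) := Real.rpow_pos_of_pos Real.pi_pos _
  have hα : 0 < 2 - α := by linarith
  have hd₀ : (0 : ℝ) < d := by linarith
  have hp₀ : (0 : ℝ) < 2 ^ (2 - α) := by linarith
  have key : stableA d α * omegaSphere d / (d * (2 - α)) =
      2 * α * Real.Gamma ((d + α) / 2) /
        ((2 : ℝ) ^ (2 - α) * ((2 - α) * Real.Gamma (1 - α / 2)) *
          (d * Real.Gamma ((d : ℝ) / 2))) := by
    unfold stableA omegaSphere
    generalize (2 : ℝ) ^ (2 - α) = p at *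
    generalize Real.Gamma (1 - α / 2) = H at *
    generalize Real.Gamma ((d : ℝ) / 2) = G at *
    generalize Real.pi ^ ((d : ℝ) / 2) = q at *
    field_simp
  rw [key, div_le_iff₀ (by positivity)]
  have hP : 0 < (d : ℝ) * Real.Gamma ((d : ℝ) / 2) := by positivity
  calc 2 * α * Real.Gamma ((d + α) / 2)
      ≤ 4 * (d * Real.Gamma ((d : ℝ) / 2)) := by
        exact mul_le_mul (by linarith) hnum
          (Real.Gamma_pos_of_pos (by positivity)).le (by norm_num)
    _ ≤ 4 * ((2 : ℝ) ^ (2 - α) * ((2 - α) * Real.Gamma (1 - α / 2)) *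
          (d * Real.Gamma ((d : ℝ) / 2))) := by
        have := le_mul_of_one_le_left hP.le (one_le_mul_of_one_le_of_one_le hpow hden)
        linarith
end

section
/- There exists a constant C > 0 such that for every integer d ≥ 1 and every α ∈ (1,2), one has | A(d,α)·ω_{d-1} / (d(2-α)) − 1 | ≤ C(2-α)·log(1+d). -/
open Real

theorem Gamma_add_le_mul_rpow {y a : ℝ} (hy : 0 < y) (ha : 0 < a) (ha1 : a < 1) :
    Real.Gamma (y + a) ≤ Real.Gamma y * y ^ a := by
  have hG : 0 < Real.Gamma y := Real.Gamma_pos_of_pos hy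
  have h := Real.Gamma_mul_add_mul_le_rpow_Gamma_mul_rpow_Gamma (s := y) (t := y + 1)
    (a := 1 - a) (b := a) hy (by linarith) (by linarith) ha (by ring)
  have e : (1 - a) * y + a * (y + 1) = y + a := by ring
  rw [e, Real.Gamma_add_one hy.ne', Real.mul_rpow hy.le hG.le] at h
  calc _ ≤ _ := h
    _ = (Real.Gamma y ^ (1 - a) * Real.Gamma y ^ a) * y ^ a := by ring
    _ = _ := by rw [← Real.rpow_add hG]; simp

theorem stableA_mul_omegaSphere_div_eq {d : ℕ} (hd : 1 ≤ d) {s : ℝ} (hs : 0 < s) :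
    stableA d (2 - 2 * s) * omegaSphere d / (d * (2 - (2 - 2 * s))) =
      (1 - s) * (4 : ℝ) ^ (-s) * Real.Gamma ((d : ℝ) / 2 + 1 - s) /
        (Real.Gamma ((d : ℝ) / 2 + 1) * Real.Gamma (s + 1)) := by
  have hd0 : (0 : ℝ) < d := by exact_mod_cast hd
  have hx : (0 : ℝ) < (d : ℝ) / 2 := by positivity
  have e1 : ((d : ℝ) + (2 - 2 * s)) / 2 = (d : ℝ) / 2 + 1 - s := by ring
  have e2 : 1 - (2 - 2 * s) / 2 = s := by ring
  have e3 : (2 : ℝ) ^ (2 - (2 - 2 * s)) = (4 : ℝ) ^ s := by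
    rw [show 2 - (2 - 2 * s) = 2 * s by ring, Real.rpow_mul (by norm_num)]
    norm_num
  have hG1 := (Real.Gamma_pos_of_pos hx).ne'
  have hG2 := (Real.Gamma_pos_of_pos hs).ne'
  have h4 : (4 : ℝ) ^ s ≠ 0 := (Real.rpow_pos_of_pos (by norm_num) s).ne'
  have hpi : Real.pi ^ ((d : ℝ) / 2) ≠ 0 := (Real.rpow_pos_of_pos Real.pi_pos _).ne'
  rw [stableA, omegaSphere, e1, e2, e3, Real.Gamma_add_one hx.ne', Real.Gamma_add_one hs.ne',
    Real.rpow_neg (by norm_num), show 2 - (2 - 2 * s) = 2 * s by ring]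
  field_simp

theorem stableA_mul_omegaSphere_div_le_one {d : ℕ} (hd : 1 ≤ d) {s : ℝ} (hs : 0 < s)
    (hs1 : s < 1) :
    stableA d (2 - 2 * s) * omegaSphere d / (d * (2 - (2 - 2 * s))) ≤ 1 := by
  rw [stableA_mul_omegaSphere_div_eq hd hs]
  have hd1 : (1 : ℝ) ≤ d := by exact_mod_cast hd
  have hx : (0 : ℝ) < (d : ℝ) / 2 := by linarith
  have hG := Real.Gamma_pos_of_pos hx
  have hS : 0 < Real.Gamma (s + 1) := Real.Gamma_pos_of_pos (by linarith)
  have hU := Gamma_add_le_mul_rpow hx (a := 1 - s) (by linarith) (by linarith)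
  rw [Real.rpow_sub hx, Real.rpow_one] at hU
  have hL : 1 ≤ Real.Gamma (s + 1) * (s + 1) := by
    have h := Gamma_add_le_mul_rpow (y := s + 1) (a := 1 - s) (by linarith) (by linarith)
      (by linarith)
    rw [show s + 1 + (1 - s) = 2 by ring, Real.Gamma_two] at h
    refine h.trans (mul_le_mul_of_nonneg_left ?_ hS.le)
    exact Real.rpow_le_self_of_one_le (by linarith) (by linarith)
  have h4x : 1 ≤ (4 : ℝ) ^ s * ((d : ℝ) / 2) ^ s := by
    rw [← Real.mul_rpow (by norm_num) hx.le]
    exact Real.one_le_rpow (by linarith) hs.le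
  have hxs : 0 < ((d : ℝ) / 2) ^ s := Real.rpow_pos_of_pos hx s
  have h4 : 0 < (4 : ℝ) ^ s := Real.rpow_pos_of_pos (by norm_num) s
  rw [Real.Gamma_add_one hx.ne', div_le_one (by positivity), Real.rpow_neg (by norm_num),
    show (d : ℝ) / 2 + 1 - s = (d : ℝ) / 2 + (1 - s) by ring]
  have hm : ((4 : ℝ) ^ s)⁻¹ * (((d : ℝ) / 2) ^ s)⁻¹ ≤ 1 := by
    rw [← mul_inv]
    exact inv_le_one_of_one_le₀ h4x
  have hone : 1 - s ≤ Real.Gamma (s + 1) := by nlinarith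
  have h1s : 0 ≤ 1 - s := by linarith
  calc (1 - s) * ((4 : ℝ) ^ s)⁻¹ * Real.Gamma ((d : ℝ) / 2 + (1 - s))
      ≤ (1 - s) * ((4 : ℝ) ^ s)⁻¹ *
          (Real.Gamma ((d : ℝ) / 2) * ((d : ℝ) / 2 / ((d : ℝ) / 2) ^ s)) := by gcongr
    _ = ((4 : ℝ) ^ s)⁻¹ * (((d : ℝ) / 2) ^ s)⁻¹ *
          ((d : ℝ) / 2 * Real.Gamma ((d : ℝ) / 2) * (1 - s)) := by ring
    _ ≤ 1 * ((d : ℝ) / 2 * Real.Gamma ((d : ℝ) / 2) * Real.Gamma (s + 1)) := by gcongr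
    _ = _ := one_mul _

theorem le_stableA_mul_omegaSphere_div {d : ℕ} (hd : 1 ≤ d) {s : ℝ} (hs : 0 < s) (hs1 : s < 1) :
    1 - s * (1 + Real.log (2 * d + 4)) ≤
      stableA d (2 - 2 * s) * omegaSphere d / (d * (2 - (2 - 2 * s))) := by
  rw [stableA_mul_omegaSphere_div_eq hd hs]
  have hd1 : (1 : ℝ) ≤ d := by exact_mod_cast hd
  have hy : (0 : ℝ) < (d : ℝ) / 2 + 1 - s := by linarith
  have hG : 0 < Real.Gamma ((d : ℝ) / 2 + 1) := Real.Gamma_pos_of_pos (by linarith)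
  have hY := Real.Gamma_pos_of_pos hy
  have hS : 0 < Real.Gamma (s + 1) := Real.Gamma_pos_of_pos (by linarith)
  have hS1 : Real.Gamma (s + 1) ≤ 1 := by
    have h := Gamma_add_le_mul_rpow (y := 1) (a := s) one_pos hs hs1
    simpa [add_comm] using h
  have hU := Gamma_add_le_mul_rpow hy hs hs1
  rw [sub_add_cancel] at hU
  have hU' : Real.Gamma ((d : ℝ) / 2 + 1) ≤
      Real.Gamma ((d : ℝ) / 2 + 1 - s) * ((d : ℝ) / 2 + 1) ^ s :=
    hU.trans (by gcongr; linarith)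
  have hE : 1 - s * Real.log (2 * d + 4) ≤ (2 * d + 4 : ℝ) ^ (-s) := by
    rw [Real.rpow_def_of_pos (by linarith)]
    have := Real.add_one_le_exp (Real.log (2 * d + 4) * -s)
    linarith
  have hsplit : (2 * d + 4 : ℝ) ^ (-s) = (4 : ℝ) ^ (-s) * (((d : ℝ) / 2 + 1) ^ s)⁻¹ := by
    rw [← Real.rpow_neg (by linarith), ← Real.mul_rpow (by norm_num) (by linarith)]
    ring_nf
  have hlog : 0 ≤ Real.log (2 * d + 4) := Real.log_nonneg (by linarith)
  have hp : 0 < ((d : ℝ) / 2 + 1) ^ s := Real.rpow_pos_of_pos (by linarith) s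
  have h1s : 0 ≤ 1 - s := by linarith
  have h4 : 0 < (4 : ℝ) ^ (-s) := Real.rpow_pos_of_pos (by norm_num) _
  have hR : (((d : ℝ) / 2 + 1) ^ s)⁻¹ * (Real.Gamma ((d : ℝ) / 2 + 1) * Real.Gamma (s + 1)) ≤
      Real.Gamma ((d : ℝ) / 2 + 1 - s) := by
    rw [inv_mul_le_iff₀ hp]
    nlinarith
  calc 1 - s * (1 + Real.log (2 * d + 4)) ≤ (1 - s) * (1 - s * Real.log (2 * d + 4)) := by
        nlinarith [mul_nonneg (mul_nonneg hs.le hs.le) hlog]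
    _ ≤ (1 - s) * ((4 : ℝ) ^ (-s) * (((d : ℝ) / 2 + 1) ^ s)⁻¹) := by
        rw [← hsplit]; gcongr
    _ ≤ _ := by
        rw [le_div_iff₀ (by positivity)]
        linarith [mul_le_mul_of_nonneg_left hR (mul_nonneg h1s h4.le)]

theorem stmt1 :
    ∃ C : ℝ, 0 < C ∧ ∀ (d : ℕ), 1 ≤ d → ∀ α : ℝ, 1 < α → α < 2 →
      |stableA d α * omegaSphere d / (d * (2 - α)) - 1| ≤
        C * (2 - α) * Real.log (1 + d) := by
  refine ⟨5 / 2, by norm_num, fun d hd α h1 h2 => ?_⟩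
  obtain ⟨s, rfl⟩ : ∃ s, α = 2 - 2 * s := ⟨1 - α / 2, by ring⟩
  have hs : 0 < s := by linarith
  have hs1 : s < 1 := by linarith
  have hd1 : (1 : ℝ) ≤ d := by exact_mod_cast hd
  have hU := stableA_mul_omegaSphere_div_le_one hd hs hs1
  have hL := le_stableA_mul_omegaSphere_div hd hs hs1
  have hlog2 : Real.log 2 ≤ Real.log (1 + d) := Real.log_le_log (by norm_num) (by linarith)
  have hlog3 : Real.log (2 * d + 4) ≤ 3 * Real.log (1 + d) := by
    have h : Real.log ((1 + d : ℝ) ^ 3) = 3 * Real.log (1 + d) := by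
      rw [Real.log_pow]; norm_num
    rw [← h]
    exact Real.log_le_log (by linarith) (by nlinarith [sq_nonneg ((d : ℝ) - 1)])
  have hkey : s * (1 + Real.log (2 * d + 4)) ≤ s * (5 * Real.log (1 + d)) := by
    have := Real.log_two_gt_d9
    gcongr
    linarith
  rw [abs_le]
  constructor
  · linarith
  · have : 0 ≤ s * Real.log (1 + d) := mul_nonneg hs.le (Real.log_nonneg (by linarith))
    linarith
end

section
/- There exists a constant C > 0 such that for every integer d ≥ 1 and every α ∈ (0,2), one has A(d,α)·ω_{d-1} / (3-α) ≤ C(2-α)·d. -/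
open Real

theorem Real.Gamma_add_le_mul_one_add {x s : ℝ} (hx : 0 < x) (hs : 0 ≤ s) (hs' : s ≤ 1) :
    Real.Gamma (x + s) ≤ Real.Gamma x * (1 + x) := by
  have h := Real.convexOn_Gamma.2 (show x ∈ Set.Ioi (0 : ℝ) from hx)
    (show x + 1 ∈ Set.Ioi (0 : ℝ) from by simp only [Set.mem_Ioi]; linarith)
    (sub_nonneg.2 hs') hs (by ring)
  simp only [smul_eq_mul, Real.Gamma_add_one hx.ne'] at h
  have hG := Real.Gamma_pos_of_pos hx
  have harg : (1 - s) * x + s * (x + 1) = x + s := by ring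
  rw [harg] at h
  nlinarith [mul_nonneg hs hG.le, mul_nonneg (mul_nonneg (sub_nonneg.2 hs') hx.le) hG.le]

theorem Real.one_le_two_mul_one_sub_mul_Gamma {s : ℝ} (hs : 0 ≤ s) (hs' : s < 1) :
    1 ≤ 2 * (1 - s) * Real.Gamma (1 - s) := by
  have h1 : 0 < 1 - s := sub_pos.2 hs'
  have hmono : Real.Gamma 2 ≤ Real.Gamma (1 - s + 1 + 1) :=
    Real.Gamma_strictMonoOn_Ici.monotoneOn (by simp) (by simp only [Set.mem_Ici]; linarith)
      (by linarith)
  rw [Real.Gamma_two, Real.Gamma_add_one (by linarith), Real.Gamma_add_one h1.ne'] at hmono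
  nlinarith [mul_pos h1 (Real.Gamma_pos_of_pos h1)]

theorem stableA_mul_omegaSphere {d : ℕ} (α : ℝ) :
    stableA d α * omegaSphere d =
      2 * α * (Real.Gamma (d / 2 + α / 2) / Real.Gamma (d / 2)) /
        ((2 : ℝ) ^ ((2 : ℝ) - α) * Real.Gamma (1 - α / 2)) := by
  have hpi : Real.pi ^ ((d : ℝ) / 2) ≠ 0 := (Real.rpow_pos_of_pos Real.pi_pos _).ne'
  rw [stableA, omegaSphere, add_div]
  generalize Real.pi ^ ((d : ℝ) / 2) = p at *
  rw [div_mul_div_comm, mul_div_assoc', div_div]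
  conv_rhs => rw [← mul_div_mul_right _ _ hpi]
  congr 1 <;> ring

theorem stmt2 :
    ∃ C : ℝ, 0 < C ∧ ∀ (d : ℕ), 1 ≤ d → ∀ α : ℝ, 0 < α → α < 2 →
      stableA d α * omegaSphere d / (3 - α) ≤ C * (2 - α) * d := by
  refine ⟨6, by norm_num, fun d hd α h0 h2 => ?_⟩
  have hd1 : (1 : ℝ) ≤ d := by exact_mod_cast hd
  have hx : (0 : ℝ) < d / 2 := by linarith
  have hG := Real.Gamma_pos_of_pos hx
  have hg : 0 < Real.Gamma (1 - α / 2) := Real.Gamma_pos_of_pos (by linarith)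
  have hratio : Real.Gamma (d / 2 + α / 2) / Real.Gamma (d / 2) ≤ 3 / 2 * d := by
    rw [div_le_iff₀ hG]
    have := Real.Gamma_add_le_mul_one_add hx (s := α / 2) (by linarith) (by linarith)
    nlinarith
  have hlow := Real.one_le_two_mul_one_sub_mul_Gamma (s := α / 2) (by linarith) (by linarith)
  have hpow : (1 : ℝ) ≤ (2 : ℝ) ^ ((2 : ℝ) - α) :=
    Real.one_le_rpow (by norm_num) (by linarith)
  have hden : 1 ≤ (2 - α) * ((2 : ℝ) ^ ((2 : ℝ) - α) * Real.Gamma (1 - α / 2)) := by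
    nlinarith [mul_nonneg (mul_nonneg (sub_pos.2 h2).le hg.le) (sub_nonneg.2 hpow)]
  have hnum : 2 * α * (Real.Gamma (d / 2 + α / 2) / Real.Gamma (d / 2)) ≤ 6 * d := by
    calc _ ≤ 2 * α * (3 / 2 * d) := by gcongr
      _ ≤ 6 * d := by nlinarith
  have hD : 0 ≤ 6 * (2 - α) * d := by
    have := sub_pos.2 h2
    positivity
  have hmain : stableA d α * omegaSphere d ≤ 6 * (2 - α) * d := by
    rw [stableA_mul_omegaSphere, div_le_iff₀ (by positivity)]
    nlinarith [mul_le_mul_of_nonneg_left hden (by positivity : (0 : ℝ) ≤ 6 * d)]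
  rw [div_le_iff₀ (by linarith)]
  nlinarith
end

section
/- For every s ∈ (0,1) and every α ∈ (0,2), one has 3-α − s^{1-α/2}/(3-α) < 2(2-α)·(1 + log(1/s)). -/
open Real

theorem stmt7 (s : ℝ) (hs0 : 0 < s) (hs1 : s < 1) (α : ℝ) (hα0 : 0 < α) (hα2 : α < 2) :
    3 - α - s ^ (1 - α / 2) / (3 - α) < 2 * (2 - α) * (1 + Real.log (1 / s)) := by
  have hlog : Real.log s < 0 := Real.log_neg hs0 hs1
  have hpow : Real.log s * (1 - α / 2) + 1 ≤ s ^ (1 - α / 2) := by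
    rw [Real.rpow_def_of_pos hs0]
    exact Real.add_one_le_exp _
  rw [one_div, Real.log_inv, sub_lt_comm, lt_div_iff₀ (by linarith)]
  refine lt_of_lt_of_le ?_ hpow
  have hβ : 0 < 2 - α := by linarith
  have ht : 0 < (2 - α) * -Real.log s := mul_pos hβ (by linarith)
  nlinarith [mul_pos hβ hβ, mul_pos ht hβ]
end

section
/- For every α ∈ (1,2), one has B(1 − 1/α, 1/2) = Γ(1 − 1/α)·Γ(1/2) / Γ(3/2 − 1/α) < 2√π/(α-1). -/
open Real

/-- The Gamma function is at most `1` on `[1, 2]`. -/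
theorem Gamma_le_one_of_mem_Icc {x : ℝ} (hx : x ∈ Set.Icc (1 : ℝ) 2) : Real.Gamma x ≤ 1 := by
  have h := Real.convexOn_Gamma.le_max_of_mem_Icc (x := 1) (y := 2) (z := x)
    (by simp) (by simp) hx
  simpa using h

/-- The Gamma function exceeds `1` on `(0, 1)`. -/
theorem one_lt_Gamma_of_mem_Ioo {x : ℝ} (hx : x ∈ Set.Ioo (0 : ℝ) 1) : 1 < Real.Gamma x := by
  simpa using Real.Gamma_strictAntiOn_Ioc (Set.Ioo_subset_Ioc_self hx)
    (Set.right_mem_Ioc.mpr one_pos) hx.2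

theorem Gamma_add_one_lt_mul_Gamma_add_half {x : ℝ} (hx0 : 0 < x) (hx : x < 1 / 2) :
    Real.Gamma (x + 1) < 2 * (1 - x) * Real.Gamma (x + 1 / 2) := by
  have h1 := Gamma_le_one_of_mem_Icc (x := x + 1) ⟨by linarith, by linarith⟩
  have h2 := one_lt_Gamma_of_mem_Ioo (x := x + 1 / 2) ⟨by linarith, by linarith⟩
  nlinarith

theorem stmt9 (α : ℝ) (hα1 : 1 < α) (hα2 : α < 2) :
    Real.Gamma (1 - 1 / α) * Real.Gamma (1 / 2) / Real.Gamma (3 / 2 - 1 / α) <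
      2 * Real.sqrt Real.pi / (α - 1) := by
  obtain ⟨x, hx⟩ : ∃ x, x = 1 - 1 / α := ⟨_, rfl⟩
  have hα : 0 < α := by linarith
  have hx0 : 0 < x := by
    rw [hx, sub_pos, div_lt_one hα]
    exact hα1
  have hx2 : x < 1 / 2 := by
    have := one_div_lt_one_div_of_lt hα hα2
    linarith
  have hxα : α * (1 - x) = 1 := by
    rw [hx]
    field_simp
    ring
  have hkey := Gamma_add_one_lt_mul_Gamma_add_half hx0 hx2
  rw [Real.Gamma_add_one hx0.ne'] at hkey
  have hG : 0 < Real.Gamma (x + 1 / 2) := Real.Gamma_pos_of_pos (by linarith)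
  have hmul : Real.Gamma x * (α - 1) < 2 * Real.Gamma (x + 1 / 2) := by
    calc Real.Gamma x * (α - 1) = α * (x * Real.Gamma x) := by
          linear_combination Real.Gamma x * hxα
      _ < α * (2 * (1 - x) * Real.Gamma (x + 1 / 2)) := by gcongr
      _ = 2 * Real.Gamma (x + 1 / 2) := by
          linear_combination 2 * Real.Gamma (x + 1 / 2) * hxα
  rw [show 3 / 2 - 1 / α = x + 1 / 2 by rw [hx]; ring, ← hx, Real.Gamma_one_half_eq,
    div_lt_div_iff₀ hG (by linarith)]
  calc Real.Gamma x * √π * (α - 1) = √π * (Real.Gamma x * (α - 1)) := by ring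
    _ < √π * (2 * Real.Gamma (x + 1 / 2)) := by gcongr
    _ = 2 * √π * Real.Gamma (x + 1 / 2) := by ring
end

section
/- For every α ∈ (1,2), one has Γ(1 − 1/α)·Γ(1/4) / Γ(5/4 − 1/α) < (2Γ(1/4)/Γ(3/4)) · 1/(α-1). -/
theorem Gamma_le_one_of_mem_Icc_s11 {y : ℝ} (h1 : 1 ≤ y) (h2 : y ≤ 2) : Real.Gamma y ≤ 1 := by
  have h := Real.convexOn_Gamma.le_max_of_mem_Icc (Set.mem_Ioi.2 one_pos)
    (Set.mem_Ioi.2 two_pos) ⟨h1, h2⟩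
  rwa [Real.Gamma_one, Real.Gamma_two, max_self] at h

theorem stmt11 (α : ℝ) (hα1 : 1 < α) (hα2 : α < 2) :
    Real.Gamma (1 - 1 / α) * Real.Gamma (1 / 4) / Real.Gamma (5 / 4 - 1 / α) <
      2 * Real.Gamma (1 / 4) / Real.Gamma (3 / 4) * (1 / (α - 1)) := by
  obtain ⟨x, hx⟩ : ∃ x, x = 1 - 1 / α := ⟨_, rfl⟩
  have hα0 : 0 < α := by linarith
  have hx0 : 0 < x := by
    rw [hx, sub_pos, div_lt_one hα0]
    exact hα1
  have hx2 : x < 1 / 2 := by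
    have : 1 / 2 < 1 / α := one_div_lt_one_div_of_lt hα0 hα2
    linarith
  have hα : 1 / (α - 1) = (1 - x) / x := by
    have : α - 1 ≠ 0 := by linarith
    rw [hx]
    field_simp
    ring
  have hG : Real.Gamma (x + 1) ≤ 1 := Gamma_le_one_of_mem_Icc_s11 (by linarith) (by linarith)
  have hA : Real.Gamma (3 / 4) ≤ Real.Gamma (x + 1 / 4) :=
    Real.Gamma_strictAntiOn_Ioc.antitoneOn ⟨by linarith, by linarith⟩ (by norm_num) (by linarith)
  rw [Real.Gamma_add_one hx0.ne'] at hG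
  have p1 : 0 < Real.Gamma (1 / 4) := Real.Gamma_pos_of_pos (by norm_num)
  have p3 : 0 < Real.Gamma (3 / 4) := Real.Gamma_pos_of_pos (by norm_num)
  have pt : 0 < Real.Gamma (x + 1 / 4) := Real.Gamma_pos_of_pos (by linarith)
  have key : x * Real.Gamma x * Real.Gamma (3 / 4) <
      2 * (1 - x) * Real.Gamma (x + 1 / 4) := by
    calc x * Real.Gamma x * Real.Gamma (3 / 4) ≤ 1 * Real.Gamma (3 / 4) := by gcongr
      _ ≤ 1 * Real.Gamma (x + 1 / 4) := by gcongr
      _ < 2 * (1 - x) * Real.Gamma (x + 1 / 4) := by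
        gcongr
        linarith
  rw [hα, ← hx, show 5 / 4 - 1 / α = x + 1 / 4 by rw [hx]; ring, div_mul_div_comm,
    div_lt_div_iff₀ pt (by positivity)]
  have := mul_lt_mul_of_pos_left key p1
  linarith
end

section
/- There exists a constant C > 0 such that for every α ∈ (1,2), ∫_0^1 (1-τ)^{-1/α} · τ^{-1/2} · (1 + log(1/τ)) dτ ≤ C/(α-1). -/
open MeasureTheory Real

lemma rpow_neg_le_two {x b : ℝ} (hx : 1 / 2 ≤ x) (hx1 : x ≤ 1) (hb : b ≤ 1) :
    x ^ (-b) ≤ 2 := by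
  have hx0 : 0 < x := by linarith
  calc x ^ (-b) ≤ x ^ (-1 : ℝ) := rpow_le_rpow_of_exponent_ge hx0 hx1 (by linarith)
    _ = x⁻¹ := rpow_neg_one x
    _ ≤ 2 := by
      rw [inv_le_comm₀ hx0 two_pos]
      linarith

lemma one_sub_rpow_mul_rpow_le {x a b : ℝ} (hx : 0 < x) (hx1 : x < 1) (ha : a ≤ 1)
    (hb : b ≤ 1) : (1 - x) ^ (-a) * x ^ (-b) ≤ 2 * x ^ (-b) + 2 * (1 - x) ^ (-a) := by
  have h₁ : 0 ≤ (1 - x) ^ (-a) := rpow_nonneg (by linarith) _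
  have h₂ : 0 ≤ x ^ (-b) := rpow_nonneg hx.le _
  rcases le_total x (1 / 2) with h | h
  · have := rpow_neg_le_two (x := 1 - x) (by linarith) (by linarith) ha
    nlinarith
  · have := rpow_neg_le_two h hx1.le hb
    nlinarith

lemma one_add_log_one_div_le {x : ℝ} (hx : 0 < x) (hx1 : x ≤ 1) :
    1 + log (1 / x) ≤ 5 * x ^ (-(1 / 4 : ℝ)) := by
  have h₁ : 1 ≤ x ^ (-(1 / 4 : ℝ)) :=
    one_le_rpow_of_pos_of_le_one_of_nonpos hx hx1 (by norm_num)
  have h₂ := log_le_rpow_div (x := 1 / x) (by positivity) (show (0 : ℝ) < 1 / 4 by norm_num)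
  rw [one_div x, inv_rpow hx.le, ← rpow_neg hx.le] at h₂
  rw [one_div x]
  linarith

lemma integrableOn_rpow_neg_Ioo {b : ℝ} (hb : b < 1) :
    IntegrableOn (fun x : ℝ => x ^ (-b)) (Set.Ioo 0 1) := by
  rw [← intervalIntegrable_iff_integrableOn_Ioo_of_le zero_le_one]
  exact intervalIntegral.intervalIntegrable_rpow' (by linarith)

lemma integrableOn_one_sub_rpow_neg_Ioo {a : ℝ} (ha : a < 1) :
    IntegrableOn (fun x : ℝ => (1 - x) ^ (-a)) (Set.Ioo 0 1) := by
  rw [← intervalIntegrable_iff_integrableOn_Ioo_of_le zero_le_one]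
  have h : IntervalIntegrable (fun x : ℝ => x ^ (-a)) volume 0 1 :=
    intervalIntegral.intervalIntegrable_rpow' (by linarith)
  simpa using (h.comp_sub_left 1).symm

lemma setIntegral_rpow_neg_Ioo {b : ℝ} (hb : b < 1) :
    ∫ x in Set.Ioo (0 : ℝ) 1, x ^ (-b) = 1 / (1 - b) := by
  rw [← integral_Ioc_eq_integral_Ioo, ← intervalIntegral.integral_of_le zero_le_one,
    integral_rpow (Or.inl (by linarith)), one_rpow, zero_rpow (by linarith)]
  ring_nf

lemma setIntegral_one_sub_rpow_neg_Ioo {a : ℝ} (ha : a < 1) :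
    ∫ x in Set.Ioo (0 : ℝ) 1, (1 - x) ^ (-a) = 1 / (1 - a) := by
  rw [← setIntegral_rpow_neg_Ioo ha]
  simp only [← integral_Ioc_eq_integral_Ioo, ← intervalIntegral.integral_of_le zero_le_one]
  simpa using intervalIntegral.integral_comp_sub_left (a := 0) (b := 1)
    (fun x : ℝ => x ^ (-a)) 1

theorem stmt12 :
    ∃ C : ℝ, 0 < C ∧ ∀ α : ℝ, 1 < α → α < 2 →
      (∫ τ in Set.Ioo (0 : ℝ) 1,
          (1 - τ) ^ (-(1 / α)) * τ ^ (-(1 / 2 : ℝ)) * (1 + Real.log (1 / τ))) ≤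
        C / (α - 1) := by
  refine ⟨60, by norm_num, fun α h1 h2 => ?_⟩
  have hα : 0 < α - 1 := by linarith
  have ha : 1 / α < 1 := by
    rw [div_lt_one (by linarith)]
    exact h1
  have hi₁ := (integrableOn_rpow_neg_Ioo (show (3 / 4 : ℝ) < 1 by norm_num)).const_mul 10
  have hi₂ := (integrableOn_one_sub_rpow_neg_Ioo ha).const_mul 10
  calc _ ≤ ∫ τ in Set.Ioo (0 : ℝ) 1,
          (10 * τ ^ (-(3 / 4 : ℝ)) + 10 * (1 - τ) ^ (-(1 / α))) := by
        refine integral_mono_of_nonneg ?_ (hi₁.add hi₂) ?_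
        · filter_upwards [ae_restrict_mem measurableSet_Ioo] with τ ⟨h0, hτ⟩
          have := log_nonneg (one_le_one_div h0 hτ.le)
          have := rpow_nonneg (sub_nonneg.2 hτ.le) (-(1 / α))
          simp only [Pi.zero_apply]
          positivity
        · filter_upwards [ae_restrict_mem measurableSet_Ioo] with τ ⟨h0, hτ⟩
          have hnn := rpow_nonneg (sub_nonneg.2 hτ.le) (-(1 / α))
          have hsum := one_sub_rpow_mul_rpow_le h0 hτ ha.le
            (show (3 / 4 : ℝ) ≤ 1 by norm_num)
          calc _ ≤ (1 - τ) ^ (-(1 / α)) * τ ^ (-(1 / 2 : ℝ)) * (5 * τ ^ (-(1 / 4 : ℝ))) := by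
                gcongr
                exact one_add_log_one_div_le h0 hτ.le
            _ = 5 * ((1 - τ) ^ (-(1 / α)) * τ ^ (-(3 / 4 : ℝ))) := by
                rw [show (-(3 / 4 : ℝ)) = -(1 / 2) + -(1 / 4) by norm_num, rpow_add h0]
                ring
            _ ≤ _ := by linarith
    _ = 40 + 10 * (α / (α - 1)) := by
        rw [integral_add hi₁ hi₂, integral_const_mul, integral_const_mul,
          setIntegral_rpow_neg_Ioo (by norm_num), setIntegral_one_sub_rpow_neg_Ioo ha]
        field_simp
        ring
    _ ≤ 60 / (α - 1) := by
        rw [le_div_iff₀ hα, add_mul, mul_assoc, div_mul_cancel₀ _ hα.ne']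
        linarith
end
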